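/- Let D = (V,E,w) be a vertex-weighted oriented complete bipartite graph: V = V_1 ⊔ V_2 with V_1, V_2 nonempty, E consists of all pairs (x,y) with x ∈ V_1, y ∈ V_2 (every edge directed from V_1 to V_2), and w(x) = 1 for every x ∈ V_1 (the sources). Then pd(I(D)) = |V| − 2. -/

import Mathlib

open MvPolynomial

noncomputable section

namespace WOG

variable {k : Type} [Field k]

/-- The maximal graded ideal `(x : x ∈ V)` of the polynomial ring. -/
def mIdeal (k V : Type) [Field k] : Ideal (MvPolynomial V k) :=
  Ideal.span (Set.range (X : V → MvPolynomial V k))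

/-- The edge ideal `I(D) = (x * y^{w(y)} : (x,y) ∈ E)` of a vertex-weighted
oriented graph `D = (V, E, w)`. -/
def edgeIdeal (k : Type) [Field k] {V : Type} (E : Set (V × V)) (w : V → ℕ) :
    Ideal (MvPolynomial V k) :=
  Ideal.span {p : MvPolynomial V k | ∃ e ∈ E, p = X e.1 * X e.2 ^ w e.2}

/-- A minimal graded free resolution `⋯ → F₁ → F₀ → I → 0` of an ideal
`I` of the polynomial ring `S = k[x : x ∈ V]`, where `Fᵢ` is the graded free
module with (finite) homogeneous basis `ι i` whose element `a` sits in degree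
`deg i a` (i.e. `Fᵢ = ⊕_a S(- deg i a)`), the maps are graded (degree-preserving)
`S`-linear maps, the complex is exact, and all the matrix entries of the
differentials lie in the maximal graded ideal `𝔪 = (x : x ∈ V)` (minimality). -/
structure MinFreeRes {V : Type} (I : Ideal (MvPolynomial V k)) where
  ι : ℕ → Type
  finite : ∀ i, Finite (ι i)
  deg : ∀ i, ι i → ℕ
  aug : ((ι 0) →₀ MvPolynomial V k) →ₗ[MvPolynomial V k] MvPolynomial V k
  d : ∀ i, ((ι (i + 1)) →₀ MvPolynomial V k) →ₗ[MvPolynomial V k] ((ι i) →₀ MvPolynomial V k)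
  aug_range : LinearMap.range aug = I
  exact_zero : LinearMap.range (d 0) = LinearMap.ker aug
  exact_succ : ∀ i, LinearMap.range (d (i + 1)) = LinearMap.ker (d i)
  aug_homog : ∀ a, (aug (Finsupp.single a 1)).IsHomogeneous (deg 0 a)
  d_homog : ∀ i a b, (d i (Finsupp.single a 1)) b = 0 ∨
      ∃ e, deg (i + 1) a = deg i b + e ∧ ((d i (Finsupp.single a 1)) b).IsHomogeneous e
  minimal : ∀ i a b, (d i (Finsupp.single a 1)) b ∈ mIdeal k V

/-- The graded Betti number `β_{i,j}(I)`, read off from a minimal graded free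
resolution: the number of basis elements of `Fᵢ` of degree `j`. -/
def MinFreeRes.betti {V : Type} {I : Ideal (MvPolynomial V k)} (R : MinFreeRes I)
    (i j : ℕ) : ℕ :=
  Nat.card {a : R.ι i // R.deg i a = j}

/-- The set `{j - i : β_{i,j}(I) ≠ 0}`; its greatest element is the
Castelnuovo–Mumford regularity `reg I`. -/
def MinFreeRes.regSet {V : Type} {I : Ideal (MvPolynomial V k)} (R : MinFreeRes I) :
    Set ℤ :=
  {t : ℤ | ∃ i j : ℕ, R.betti i j ≠ 0 ∧ t = (j : ℤ) - (i : ℤ)}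

/-- The set `{i : β_{i,j}(I) ≠ 0 for some j}`; its greatest element is the
projective dimension `pd I`. -/
def MinFreeRes.pdSet {V : Type} {I : Ideal (MvPolynomial V k)} (R : MinFreeRes I) :
    Set ℕ :=
  {i : ℕ | ∃ j : ℕ, R.betti i j ≠ 0}

/-- The set of lengths of `I`-regular sequences contained in the maximal graded
ideal `𝔪 = (x : x ∈ V)`; its greatest element is `depth I`. -/
def depthSet (k : Type) [Field k] {V : Type} (I : Ideal (MvPolynomial V k)) : Set ℕ :=
  {n : ℕ | ∃ rs : List (MvPolynomial V k), rs.length = n ∧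
    (∀ r ∈ rs, r ∈ mIdeal k V) ∧ RingTheory.Sequence.IsRegular (↥I) rs}

end WOG

open CategoryTheory Abelian

namespace WOG

section ExtVanishing

variable {S : Type} [CommRing S] {M N L : Type} [AddCommGroup M] [AddCommGroup N] [AddCommGroup L]
  [Module S M] [Module S N] [Module S L]

/-- The vanishing of `Ext^n(M, S/m)`. -/
def ExtVanish (m : Ideal S) (M : Type) [AddCommGroup M] [Module S M] (n : ℕ) : Prop :=
  Subsingleton (Ext (ModuleCat.of S M) (ModuleCat.of S (S ⧸ m)) n)

/-- The largest `n` with `Ext^n(M, S/m) ≠ 0` is `r`. -/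
def ExtTop (m : Ideal S) (M : Type) [AddCommGroup M] [Module S M] (r : ℕ) : Prop :=
  ¬ ExtVanish m M r ∧ ∀ i, r < i → ExtVanish m M i

variable {m : Ideal S} {f : M →ₗ[S] N} {g : N →ₗ[S] L}

lemma extVanish_of_projective [Module.Projective S M] (n : ℕ) : ExtVanish m M (n + 1) := by
  have : Projective (ModuleCat.of S M) := (IsProjective.iff_projective _).mp inferInstance
  exact Ext.subsingleton_of_projective _ _ _

lemma extVanish_zero_iff : ExtVanish m M 0 ↔ ∀ h : M →ₗ[S] (S ⧸ m), h = 0 := by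
  unfold ExtVanish
  rw [Ext.homEquiv₀.subsingleton_congr, ModuleCat.homEquiv.subsingleton_congr]
  exact subsingleton_iff_forall_eq 0

/-- The short exact sequence of module objects given by an exact pair of linear maps. -/
abbrev shortComplex (hfg : Function.Exact f g) : ShortComplex (ModuleCat.{0} S) :=
  ModuleCat.shortComplexOfCompEqZero f g hfg.linearMap_comp_eq_zero

lemma shortComplex_shortExact (hfg : Function.Exact f g) (hf : Function.Injective f)
    (hg : Function.Surjective g) : (shortComplex hfg).ShortExact :=
  ModuleCat.shortComplex_shortExact _ hfg hf hg

lemma extVanish_middle (hfg : Function.Exact f g) (hf : Function.Injective f)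
    (hg : Function.Surjective g) {n : ℕ} (hM : ExtVanish m M n) (hL : ExtVanish m L n) :
    ExtVanish m N n := by
  unfold ExtVanish at *
  refine subsingleton_of_forall_eq 0 fun x => ?_
  obtain ⟨y, rfl⟩ := Ext.contravariant_sequence_exact₂ (shortComplex_shortExact hfg hf hg) _ x
    (hM.elim _ _)
  rw [hL.elim y 0, Ext.comp_zero]

lemma extVanish_left (hfg : Function.Exact f g) (hf : Function.Injective f)
    (hg : Function.Surjective g) {n : ℕ} (hN : ExtVanish m N n) (hL : ExtVanish m L (n + 1)) :
    ExtVanish m M n := by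
  unfold ExtVanish at *
  refine subsingleton_of_forall_eq 0 fun x => ?_
  obtain ⟨y, rfl⟩ := Ext.contravariant_sequence_exact₁ (shortComplex_shortExact hfg hf hg) _ x
    (add_comm 1 n) (hL.elim _ _)
  rw [hN.elim y 0, Ext.comp_zero]

lemma extVanish_right (hfg : Function.Exact f g) (hf : Function.Injective f)
    (hg : Function.Surjective g) {n : ℕ} (hM : ExtVanish m M n) (hN : ExtVanish m N (n + 1)) :
    ExtVanish m L (n + 1) := by
  unfold ExtVanish at *
  refine subsingleton_of_forall_eq 0 fun x => ?_
  obtain ⟨y, rfl⟩ := Ext.contravariant_sequence_exact₃ (shortComplex_shortExact hfg hf hg) _ x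
    (hN.elim _ _) (add_comm 1 n)
  rw [hM.elim y 0, Ext.comp_zero]

/-- If `f` induces zero on `Ext^n`, the connecting map out of `Ext^n(M)` is injective. -/
lemma extVanish_left_of_comp_eq_zero (hfg : Function.Exact f g) (hf : Function.Injective f)
    (hg : Function.Surjective g) {n : ℕ}
    (h0 : ∀ x : Ext (ModuleCat.of S N) (ModuleCat.of S (S ⧸ m)) n,
      (Ext.mk₀ (ModuleCat.ofHom f)).comp x (zero_add n) = 0)
    (hL : ExtVanish m L (n + 1)) : ExtVanish m M n := by
  unfold ExtVanish at *
  refine subsingleton_of_forall_eq 0 fun x => ?_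
  obtain ⟨y, rfl⟩ := Ext.contravariant_sequence_exact₁ (shortComplex_shortExact hfg hf hg) _ x
    (add_comm 1 n) (hL.elim _ _)
  exact h0 y

lemma smul_ext_eq_zero {r : S} (hr : r ∈ m) {n : ℕ} {A : ModuleCat.{0} S}
    (x : Ext A (ModuleCat.of S (S ⧸ m)) n) : r • x = 0 := by
  have h : r • 𝟙 (ModuleCat.of S (S ⧸ m)) = 0 := by
    ext
    change Ideal.Quotient.mk m (r * 1) = 0
    rwa [mul_one, Ideal.Quotient.eq_zero_iff_mem]
  rw [← Ext.comp_mk₀_id x, ← Ext.comp_smul, ← Ext.mk₀_smul, h, Ext.mk₀_zero, Ext.comp_zero]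

/-- Dividing out an `M`-regular element of `m` shifts the top nonvanishing degree by one. -/
lemma ExtTop.succ {r : S} {g : M →ₗ[S] L} (hr : r ∈ m)
    (hfg : Function.Exact (LinearMap.lsmul S M r) g) (hf : IsSMulRegular M r)
    (hg : Function.Surjective g) {n : ℕ} (hM : ExtTop m M n) : ExtTop m L (n + 1) := by
  refine ⟨fun h => hM.1 (extVanish_left_of_comp_eq_zero hfg hf hg (fun x => ?_) h), fun i hi => ?_⟩
  · have : ModuleCat.ofHom (LinearMap.lsmul S M r) = r • 𝟙 (ModuleCat.of S M) := rfl
    rw [this, Ext.mk₀_smul, Ext.smul_comp, Ext.mk₀_id_comp, smul_ext_eq_zero hr]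
  · obtain ⟨j, rfl⟩ : ∃ j, i = j + 1 := ⟨i - 1, by omega⟩
    exact extVanish_right hfg hf hg (hM.2 j (by omega)) (hM.2 _ (by omega))

lemma extTop_quotient_bot (hm : m ≠ ⊤) : ExtTop m (S ⧸ (⊥ : Ideal S)) 0 := by
  refine ⟨fun h => ?_, fun i hi => ?_⟩
  · have h1 := LinearMap.congr_fun
      (extVanish_zero_iff.1 h (Submodule.factor bot_le)) (Submodule.Quotient.mk 1)
    exact hm ((Ideal.eq_top_iff_one _).2 ((Submodule.Quotient.mk_eq_zero _).1 h1))
  · obtain ⟨j, rfl⟩ : ∃ j, i = j + 1 := ⟨i - 1, by omega⟩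
    have : Module.Projective S (S ⧸ (⊥ : Ideal S)) :=
      .of_equiv (Submodule.quotEquivOfEqBot (⊥ : Ideal S) rfl).symm
    exact extVanish_of_projective j

/-- The Mayer–Vietoris bound for `S/(I ∩ J)`. -/
lemma extTop_quotient_inf {I J : Ideal S} {a b : ℕ} (ha : 0 < a) (hb : 0 < b)
    (hI : ExtTop m (S ⧸ I) a) (hJ : ExtTop m (S ⧸ J) b) (hIJ : ExtTop m (S ⧸ (I ⊔ J)) (a + b)) :
    ExtTop m (S ⧸ (I ⊓ J)) (a + b - 1) := by
  have hprod : ∀ i, a + b ≤ i → ExtVanish m ((S ⧸ I) × (S ⧸ J)) i := fun i hi =>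
    extVanish_middle (f := LinearMap.inl S _ _) (g := LinearMap.snd S _ _)
      Function.Exact.inl_snd LinearMap.inl_injective LinearMap.snd_surjective
      (hI.2 i (by omega)) (hJ.2 i (by omega))
  let f : (S ⧸ (I ⊓ J)) →ₗ[S] (S ⧸ I) × (S ⧸ J) :=
    (Submodule.factor inf_le_left).prod (Submodule.factor inf_le_right)
  let g : (S ⧸ I) × (S ⧸ J) →ₗ[S] S ⧸ (I ⊔ J) :=
    (Submodule.factor le_sup_left).coprod (-Submodule.factor le_sup_right)
  have hf : Function.Injective f := by
    rw [injective_iff_map_eq_zero]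
    intro x hx
    obtain ⟨x, rfl⟩ := Submodule.Quotient.mk_surjective _ x
    have h1 := congrArg Prod.fst hx
    have h2 := congrArg Prod.snd hx
    exact (Submodule.Quotient.mk_eq_zero _).2
      ⟨(Submodule.Quotient.mk_eq_zero _).1 h1, (Submodule.Quotient.mk_eq_zero _).1 h2⟩
  have hg : Function.Surjective g := by
    intro x
    obtain ⟨x, rfl⟩ := Submodule.Quotient.mk_surjective _ x
    exact ⟨(Submodule.Quotient.mk x, 0), by simp [g]⟩
  have hfg : Function.Exact f g := by
    rintro ⟨x, y⟩
    obtain ⟨x, rfl⟩ := Submodule.Quotient.mk_surjective _ x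
    obtain ⟨y, rfl⟩ := Submodule.Quotient.mk_surjective _ y
    have e : g (Submodule.Quotient.mk x, Submodule.Quotient.mk y) =
        Submodule.Quotient.mk (x - y) := by
      simp [g, sub_eq_add_neg]
    rw [e, Submodule.Quotient.mk_eq_zero]
    constructor
    · intro h
      obtain ⟨u, hu, v, hv, huv⟩ := Submodule.mem_sup.1 h
      refine ⟨Submodule.Quotient.mk (x - u), Prod.ext ?_ ?_⟩
      · refine (Submodule.Quotient.eq I).2 ?_
        simpa using hu
      · refine (Submodule.Quotient.eq J).2 ?_
        have : v = x - u - y := by linear_combination huv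
        exact this ▸ hv
    · rintro ⟨z, hz⟩
      obtain ⟨z, rfl⟩ := Submodule.Quotient.mk_surjective _ z
      have h1 : z - x ∈ I := (Submodule.Quotient.eq I).1 (congrArg Prod.fst hz)
      have h2 : z - y ∈ J := (Submodule.Quotient.eq J).1 (congrArg Prod.snd hz)
      exact Submodule.mem_sup.2 ⟨-(z - x), I.neg_mem h1, z - y, h2, by ring⟩
  obtain ⟨c, hc⟩ : ∃ c, a + b = c + 1 := ⟨a + b - 1, by omega⟩
  rw [hc] at hIJ hprod ⊢
  refine ⟨fun h => hIJ.1 (extVanish_right hfg hf hg h (hprod _ le_rfl)), fun i hi => ?_⟩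
  exact extVanish_left hfg hf hg (hprod i (by omega)) (hIJ.2 _ (by omega))

/-- Passing from `S/I` to `I` lowers the top nonvanishing degree by one. -/
lemma ExtTop.ideal {I : Ideal S} {n : ℕ} (h : ExtTop m (S ⧸ I) (n + 1)) : ExtTop m I n := by
  have hfg : Function.Exact I.subtype I.mkQ := LinearMap.exact_subtype_mkQ I
  refine ⟨fun h' => h.1 (extVanish_right hfg I.injective_subtype I.mkQ_surjective h'
    (extVanish_of_projective n)), fun i hi => ?_⟩
  obtain ⟨j, rfl⟩ : ∃ j, i = j + 1 := ⟨i - 1, by omega⟩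
  exact extVanish_left hfg I.injective_subtype I.mkQ_surjective (extVanish_of_projective j)
    (h.2 _ (by omega))

end ExtVanishing

section Resolution

variable {S : Type} [CommRing S] {m : Ideal S} {ι : Type} {L G : Type} [AddCommGroup L]
  [Module S L] [AddCommGroup G] [Module S G]
  {φ : (ι →₀ S) →ₗ[S] L} {d : G →ₗ[S] (ι →₀ S)}

lemma linearMap_eq_zero_of_coeff_mem {v : ι →₀ S} (hv : ∀ b, v b ∈ m)
    (h : (ι →₀ S) →ₗ[S] (S ⧸ m)) : h v = 0 := by
  rw [← Finsupp.sum_single v, map_finsuppSum]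
  refine Finset.sum_eq_zero fun b _ => ?_
  obtain ⟨y, hy⟩ := Submodule.Quotient.mk_surjective _ (h (Finsupp.single b 1))
  change h (Finsupp.single b (v b)) = 0
  rw [← mul_one (v b), ← smul_eq_mul, ← Finsupp.smul_single, map_smul, ← hy,
    ← Submodule.Quotient.mk_smul, Submodule.Quotient.mk_eq_zero]
  exact m.mul_mem_right _ (hv b)

lemma exact_subtype_rangeRestrict (hd : LinearMap.range d = LinearMap.ker φ) :
    Function.Exact (LinearMap.range d).subtype φ.rangeRestrict := by
  rw [LinearMap.exact_iff, LinearMap.ker_rangeRestrict, Submodule.range_subtype, hd]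

lemma extVanish_range_succ_iff (hd : LinearMap.range d = LinearMap.ker φ)
    (hmin : ∀ x b, d x b ∈ m) (n : ℕ) :
    ExtVanish m (LinearMap.range φ) (n + 1) ↔ ExtVanish m (LinearMap.range d) n := by
  have hex := exact_subtype_rangeRestrict hd
  refine ⟨extVanish_left_of_comp_eq_zero hex (Submodule.injective_subtype _)
    φ.surjective_rangeRestrict fun x => ?_, fun h => extVanish_right hex
    (Submodule.injective_subtype _) φ.surjective_rangeRestrict h (extVanish_of_projective n)⟩
  cases n with
  | zero =>
    obtain ⟨h, rfl⟩ := Ext.homEquiv₀.symm.surjective x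
    change (Ext.mk₀ _).comp (Ext.mk₀ h) _ = 0
    rw [Ext.mk₀_comp_mk₀, Ext.mk₀_eq_zero_iff]
    ext ⟨_, y, rfl⟩
    exact linearMap_eq_zero_of_coeff_mem (hmin y) h.hom
  | succ n =>
    rw [(extVanish_of_projective (m := m) (M := ι →₀ S) n).elim x 0, Ext.comp_zero]

lemma extVanish_range_zero_iff (hm : m ≠ ⊤) (hd : LinearMap.range d = LinearMap.ker φ)
    (hmin : ∀ x b, d x b ∈ m) : ExtVanish m (LinearMap.range φ) 0 ↔ IsEmpty ι := by
  rw [extVanish_zero_iff]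
  constructor
  · intro h
    by_contra hne
    obtain ⟨b⟩ := not_isEmpty_iff.1 hne
    let p : (ι →₀ S) →ₗ[S] (S ⧸ m) := m.mkQ ∘ₗ Finsupp.lapply b
    have hp : LinearMap.ker φ ≤ LinearMap.ker p := by
      rw [← hd]
      rintro _ ⟨y, rfl⟩
      exact linearMap_eq_zero_of_coeff_mem (hmin y) p
    have h1 := LinearMap.congr_fun
      (h ((Submodule.liftQ _ p hp) ∘ₗ φ.quotKerEquivRange.symm.toLinearMap))
      (φ.quotKerEquivRange (Submodule.Quotient.mk (Finsupp.single b 1)))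
    simp only [LinearMap.comp_apply, LinearEquiv.coe_coe, LinearEquiv.symm_apply_apply,
      LinearMap.zero_apply] at h1
    have h2 : Ideal.Quotient.mk m (Finsupp.single b (1 : S) b) = 0 := h1
    rw [Finsupp.single_eq_same, Ideal.Quotient.eq_zero_iff_mem] at h2
    exact hm ((Ideal.eq_top_iff_one _).2 h2)
  · intro hι h
    ext ⟨_, y, rfl⟩
    have hy : (⟨φ y, y, rfl⟩ : LinearMap.range φ) = 0 :=
      Subtype.ext ((congrArg φ (Subsingleton.elim y 0)).trans φ.map_zero)
    rw [hy, map_zero, map_zero]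

end Resolution

variable {k : Type} [Field k] {V : Type} {I : Ideal (MvPolynomial V k)}

lemma MinFreeRes.d_mem (R : MinFreeRes I) (i : ℕ) (x : R.ι (i + 1) →₀ MvPolynomial V k)
    (b : R.ι i) : R.d i x b ∈ mIdeal k V := by
  induction x using Finsupp.induction_linear with
  | zero => simp
  | add x y hx hy => simpa using add_mem hx hy
  | single a c =>
    rw [← mul_one c, ← smul_eq_mul, ← Finsupp.smul_single, map_smul, Finsupp.smul_apply]
    exact Ideal.mul_mem_left _ _ (R.minimal i a b)

lemma mIdeal_ne_top : mIdeal k V ≠ ⊤ := by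
  intro h
  have : mIdeal k V ≤ RingHom.ker (constantCoeff : MvPolynomial V k →+* k) := by
    rw [mIdeal, Ideal.span_le]
    rintro _ ⟨v, rfl⟩
    simp
  rw [h] at this
  simpa using this (Submodule.mem_top : (1 : MvPolynomial V k) ∈ _)

lemma MinFreeRes.extVanish_range_d_iff (R : MinFreeRes I) (i j : ℕ) :
    ExtVanish (mIdeal k V) (LinearMap.range (R.d i)) j ↔ IsEmpty (R.ι (i + 1 + j)) := by
  induction j generalizing i with
  | zero => exact extVanish_range_zero_iff mIdeal_ne_top (R.exact_succ i) (R.d_mem (i + 1))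
  | succ j ih =>
    rw [extVanish_range_succ_iff (R.exact_succ i) (R.d_mem (i + 1)), ih,
      show i + 1 + 1 + j = i + 1 + (j + 1) by ring]

/-- `Ext^j(I, k)` vanishes exactly when the `j`-th module of a minimal free resolution does. -/
lemma MinFreeRes.extVanish_iff (R : MinFreeRes I) (j : ℕ) :
    ExtVanish (mIdeal k V) I j ↔ IsEmpty (R.ι j) := by
  have h : ExtVanish (mIdeal k V) (LinearMap.range R.aug) j ↔ IsEmpty (R.ι j) := by
    cases j with
    | zero => exact extVanish_range_zero_iff mIdeal_ne_top R.exact_zero (R.d_mem 0)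
    | succ j =>
      rw [extVanish_range_succ_iff R.exact_zero (R.d_mem 0), R.extVanish_range_d_iff,
        show 0 + 1 + j = j + 1 by ring]
  rwa [R.aug_range] at h

lemma MinFreeRes.mem_pdSet_iff (R : MinFreeRes I) (i : ℕ) :
    i ∈ R.pdSet ↔ Nonempty (R.ι i) := by
  have := R.finite i
  constructor
  · rintro ⟨j, hj⟩
    obtain ⟨⟨a, -⟩⟩ := (Nat.card_ne_zero.1 hj).1
    exact ⟨a⟩
  · rintro ⟨a⟩
    exact ⟨R.deg i a, Nat.card_ne_zero.2 ⟨⟨⟨a, rfl⟩⟩, inferInstance⟩⟩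

lemma MinFreeRes.isGreatest_pdSet (R : MinFreeRes I) {n : ℕ}
    (h : ExtTop (mIdeal k V) I n) : IsGreatest R.pdSet n := by
  refine ⟨?_, fun i hi => ?_⟩
  · rw [R.mem_pdSet_iff, ← not_isEmpty_iff, ← R.extVanish_iff]
    exact h.1
  · rw [R.mem_pdSet_iff, ← not_isEmpty_iff, ← R.extVanish_iff] at hi
    by_contra! hlt
    exact hi (h.2 i hlt)

section PowerIdeal

/-- The ideal generated by the powers `x^{a(x)}` of the variables `x ∈ s`. -/
def powerIdeal (k : Type) [Field k] {V : Type} (a : V → ℕ) (s : Set V) :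
    Ideal (MvPolynomial V k) :=
  Ideal.span ((fun v => X v ^ a v) '' s)

variable {a : V → ℕ} {s t : Set V} {p : MvPolynomial V k}

lemma mem_powerIdeal_iff : p ∈ powerIdeal k a s ↔ ∀ e ∈ p.support, ∃ v ∈ s, a v ≤ e v := by
  have h : (fun v => (X v ^ a v : MvPolynomial V k)) '' s =
      (fun e => monomial e 1) '' ((fun v => Finsupp.single v (a v)) '' s) := by
    simp only [Set.image_image, X_pow_eq_monomial]
  rw [powerIdeal, h, mem_ideal_span_monomial_image]
  simp

lemma powerIdeal_union : powerIdeal k a (s ∪ t) = powerIdeal k a s ⊔ powerIdeal k a t := by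
  rw [powerIdeal, Set.image_union, Ideal.span_union, powerIdeal, powerIdeal]

lemma mem_powerIdeal_of_mul_mem {v : V} (hv : v ∉ s) {n : ℕ}
    (h : X v ^ n * p ∈ powerIdeal k a s) : p ∈ powerIdeal k a s := by
  rw [mem_powerIdeal_iff] at h ⊢
  intro e he
  obtain ⟨u, hu, hle⟩ := h (Finsupp.single v n + e) (by
    rwa [mem_support_iff, X_pow_eq_monomial, coeff_monomial_mul, one_mul, ← mem_support_iff])
  refine ⟨u, hu, ?_⟩
  have huv : u ≠ v := ne_of_mem_of_not_mem hu hv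
  rwa [Finsupp.add_apply, Finsupp.single_eq_of_ne huv, zero_add] at hle

lemma extTop_quotient_powerIdeal (ha : ∀ v, 1 ≤ a v) (s : Finset V) :
    ExtTop (mIdeal k V) (MvPolynomial V k ⧸ powerIdeal k a s) s.card := by
  classical
  induction s using Finset.induction_on with
  | empty =>
    have h : powerIdeal k a ((∅ : Finset V) : Set V) = ⊥ := by simp [powerIdeal]
    rw [h, Finset.card_empty]
    exact extTop_quotient_bot mIdeal_ne_top
  | insert v s hv ih =>
    have hins : powerIdeal k a ↑(insert v s) =
        Ideal.span {X v ^ a v} ⊔ powerIdeal k a (s : Set V) := by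
      rw [Finset.coe_insert, Set.insert_eq, powerIdeal_union, powerIdeal, Set.image_singleton]
    have hle : powerIdeal k a (s : Set V) ≤ powerIdeal k a ↑(insert v s) := hins ▸ le_sup_right
    rw [Finset.card_insert_of_notMem hv]
    refine ih.succ (r := X v ^ a v) (g := Submodule.factor hle) ?_ ?_ ?_
      (Submodule.factor_surjective hle)
    · exact Ideal.pow_mem_of_mem _ (Ideal.subset_span (Set.mem_range_self v)) _ (ha v)
    · intro x
      obtain ⟨x, rfl⟩ := Submodule.Quotient.mk_surjective _ x
      change Submodule.Quotient.mk x = 0 ↔ _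
      rw [Submodule.Quotient.mk_eq_zero, hins, Ideal.mem_span_singleton_sup]
      constructor
      · rintro ⟨c, b, hb, rfl⟩
        refine ⟨Submodule.Quotient.mk c, (Submodule.Quotient.eq _).2 ?_⟩
        have : -b = X v ^ a v * c - (c * X v ^ a v + b) := by ring
        exact this ▸ neg_mem hb
      · rintro ⟨c, hc⟩
        obtain ⟨c, rfl⟩ := Submodule.Quotient.mk_surjective _ c
        have h : X v ^ a v * c - x ∈ powerIdeal k a (s : Set V) := (Submodule.Quotient.eq _).1 hc
        exact ⟨c, _, neg_mem h, by ring⟩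
    · rw [isSMulRegular_iff_right_eq_zero_of_smul]
      intro x hx
      obtain ⟨x, rfl⟩ := Submodule.Quotient.mk_surjective _ x
      exact (Submodule.Quotient.mk_eq_zero _).2
        (mem_powerIdeal_of_mul_mem hv ((Submodule.Quotient.mk_eq_zero _).1 hx))

lemma edgeIdeal_prod (hst : Disjoint s t) (hs : ∀ v ∈ s, a v = 1) :
    edgeIdeal k (s ×ˢ t) a = powerIdeal k a s ⊓ powerIdeal k a t := by
  have h : {p : MvPolynomial V k | ∃ e ∈ s ×ˢ t, p = X e.1 * X e.2 ^ a e.2} =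
      (fun e => monomial e 1) ''
        ((fun e => Finsupp.single e.1 1 + Finsupp.single e.2 (a e.2)) '' (s ×ˢ t)) := by
    ext p
    simp only [Set.image_image, Set.mem_image, Set.mem_ofPred_eq, X_pow_eq_monomial,
      eq_comm (a := p)]
    simp only [X, monomial_mul, one_mul]
  classical
  ext p
  rw [edgeIdeal, h, mem_ideal_span_monomial_image, Ideal.mem_inf, mem_powerIdeal_iff,
    mem_powerIdeal_iff, ← forall₂_and]
  refine forall₂_congr fun e _ => ⟨?_, ?_⟩
  · rintro ⟨_, ⟨⟨u, v⟩, ⟨hu, hv⟩, rfl⟩, hle⟩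
    refine ⟨⟨u, hu, ?_⟩, v, hv, ?_⟩
    · rw [hs u hu]
      refine le_trans ?_ (hle u)
      simp
    · refine le_trans ?_ (hle v)
      simp
  · rintro ⟨⟨u, hu, hue⟩, v, hv, hve⟩
    refine ⟨_, ⟨(u, v), ⟨hu, hv⟩, rfl⟩, fun x => ?_⟩
    rw [hs u hu] at hue
    have huv : u ≠ v := fun h => Set.disjoint_left.1 hst hu (h ▸ hv)
    simp only [Finsupp.add_apply, Finsupp.single_apply]
    split_ifs with h1 h2
    · exact absurd (h1.trans h2.symm) huv
    all_goals subst_vars; omega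

end PowerIdeal

/-- For disjoint nonempty `s`, `t` with weights one on `s`, the top nonvanishing `Ext` of the
edge ideal of the complete bipartite graph directed from `s` to `t`. -/
lemma extTop_edgeIdeal_prod {a : V → ℕ} (ha : ∀ v, 1 ≤ a v) {s t : Finset V}
    (hst : Disjoint s t) (hs : s.Nonempty) (ht : t.Nonempty) (has : ∀ v ∈ s, a v = 1) :
    ExtTop (mIdeal k V) (edgeIdeal k ((s : Set V) ×ˢ (t : Set V)) a) (s.card + t.card - 2) := by
  classical
  have hs' := hs.card_pos
  have ht' := ht.card_pos
  rw [edgeIdeal_prod (Finset.disjoint_coe.2 hst) has]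
  refine ExtTop.ideal ?_
  rw [show s.card + t.card - 2 + 1 = s.card + t.card - 1 by omega]
  refine extTop_quotient_inf hs' ht' (extTop_quotient_powerIdeal ha s)
    (extTop_quotient_powerIdeal ha t) ?_
  rw [← powerIdeal_union, ← Finset.coe_union, ← Finset.card_union_of_disjoint hst]
  exact extTop_quotient_powerIdeal ha (s ∪ t)

end WOG

/-- **Lemma (complete bipartite, regularity).**
`D` is a vertex-weighted oriented complete bipartite graph: the vertex set is
partitioned into nonempty parts `V_1, V_2` (encoded by `part : V → Fin 2`),
the edges are exactly all pairs `(x, y)` with `x ∈ V_1`, `y ∈ V_2`, and the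
sources (the vertices of `V_1`) have weight `1`.
Then `pd I(D) = |V| - 2`. -/
theorem complete_bipartite_pd (k : Type) [Field k]
    (V : Type) [Fintype V] (part : V → Fin 2) (hpart : ∀ i : Fin 2, ∃ x : V, part x = i)
    (E : Set (V × V))
    (hE : E = {p : V × V | (part p.1 : ℕ) = 0 ∧ (part p.2 : ℕ) = 1})
    (w : V → ℕ) (hw : ∀ x : V, 1 ≤ w x)
    (hw1 : ∀ x : V, (part x : ℕ) = 0 → w x = 1)
    (R : WOG.MinFreeRes (WOG.edgeIdeal k E w)) :
    IsGreatest R.pdSet (Fintype.card V - 2) := by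
  classical
  let s : Finset V := {v | part v = 0}
  let t : Finset V := {v | part v = 1}
  have hst : Disjoint s t := by
    rw [Finset.disjoint_filter]
    intro v _ h0 h1
    exact absurd (h0.symm.trans h1) (by decide)
  have hE' : E = (s : Set V) ×ˢ (t : Set V) := by
    ext p
    simp only [hE, s, t, Set.mem_ofPred_eq, Set.mem_prod, Finset.mem_coe, Finset.mem_filter,
      Finset.mem_univ, true_and]
    omega
  have hcard : Fintype.card V = s.card + t.card := by
    rw [← Finset.card_union_of_disjoint hst, ← Finset.card_univ]
    congr 1
    ext v
    simp only [s, t, Finset.mem_union, Finset.mem_filter, Finset.mem_univ, true_and, true_iff]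
    omega
  obtain ⟨x, hx⟩ := hpart 0
  obtain ⟨y, hy⟩ := hpart 1
  subst hE'
  rw [hcard]
  refine R.isGreatest_pdSet (WOG.extTop_edgeIdeal_prod hw hst ⟨x, by simp [s, hx]⟩
    ⟨y, by simp [t, hy]⟩ fun v hv => hw1 v ?_)
  simp_all [s]
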